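/- (ψ-Nash inequality) There exists a constant C > 0 such that for every continuously differentiable nonzero function f : Ω → ℝ with f ∈ L¹(Ω) ∩ L²(Ω) and ∇f ∈ L²(Ω), one has ‖∇f‖_{L²(Ω)} ≥ C ‖f‖_{L²(Ω)} · min{ ‖f‖_{L²(Ω)}/‖f‖_{L¹(Ω)} , ‖f‖²_{L²(Ω)}/‖f‖²_{L¹(Ω)} }. -/

import Mathlib

noncomputable section

open MeasureTheory Real

namespace NS

/-- The measure on the cylinder `Ω = ℝ × 𝕋`, identified with `ℝ × [0,1)`. -/
def μΩ : Measure (ℝ × ℝ) := volume.restrict (Set.univ ×ˢ Set.Ico (0:ℝ) 1)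

/-- First partial derivative of a function on `ℝ²`. -/
def pd1 (g : ℝ × ℝ → ℝ) (x : ℝ × ℝ) : ℝ := deriv (fun y => g (y, x.2)) x.1

/-- Second partial derivative of a function on `ℝ²`. -/
def pd2 (g : ℝ × ℝ → ℝ) (x : ℝ × ℝ) : ℝ := deriv (fun y => g (x.1, y)) x.2

/-- A function on the cylinder: `1`-periodic in the second variable. -/
def Periodic2 (g : ℝ × ℝ → ℝ) : Prop := ∀ x : ℝ × ℝ, g (x.1, x.2 + 1) = g x

/-- `L¹` norm on the cylinder. -/
def L1norm (f : ℝ × ℝ → ℝ) : ℝ := ∫ x, |f x| ∂μΩ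

/-- `L²` norm on the cylinder. -/
def L2norm (f : ℝ × ℝ → ℝ) : ℝ := Real.sqrt (∫ x, f x ^ 2 ∂μΩ)

/-- `L²` norm of the gradient on the cylinder. -/
def GradL2norm (f : ℝ × ℝ → ℝ) : ℝ := Real.sqrt (∫ x, (pd1 f x ^ 2 + pd2 f x ^ 2) ∂μΩ)

/-- `Ω` carries the product of Lebesgue measure on `ℝ` and on `[0,1)`. -/
lemma μΩ_eq_prod :
    μΩ = (volume : Measure ℝ).prod ((volume : Measure ℝ).restrict (Set.Ico 0 1)) := by
  rw [μΩ, Measure.volume_eq_prod, ← Measure.prod_restrict, Measure.restrict_univ]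

lemma hasDerivAt_pd1 {g : ℝ × ℝ → ℝ} (hg : ContDiff ℝ 1 g) (x : ℝ × ℝ) :
    HasDerivAt (fun y => g (y, x.2)) (pd1 g x) x.1 := by
  have hd : DifferentiableAt ℝ (fun y => g (y, x.2)) x.1 :=
    ((hg.comp (contDiff_id.prodMk contDiff_const)).differentiable one_ne_zero) x.1
  exact hd.hasDerivAt

lemma hasDerivAt_pd2 {g : ℝ × ℝ → ℝ} (hg : ContDiff ℝ 1 g) (x : ℝ × ℝ) :
    HasDerivAt (fun y => g (x.1, y)) (pd2 g x) x.2 := by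
  have hd : DifferentiableAt ℝ (fun y => g (x.1, y)) x.2 :=
    ((hg.comp (contDiff_const.prodMk contDiff_id)).differentiable one_ne_zero) x.2
  exact hd.hasDerivAt

lemma continuous_pd1 {g : ℝ × ℝ → ℝ} (hg : ContDiff ℝ 1 g) : Continuous (pd1 g) := by
  have h : pd1 g = fun x => fderiv ℝ g x (1, 0) := by
    funext x
    have h1 : HasFDerivAt g (fderiv ℝ g x) (x.1, x.2) :=
      (hg.differentiable one_ne_zero x).hasFDerivAt
    exact (h1.comp_hasDerivAt x.1 ((hasDerivAt_id x.1).prodMk (hasDerivAt_const x.1 x.2))).deriv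
  rw [h]
  exact (hg.continuous_fderiv one_ne_zero).clm_apply continuous_const

lemma continuous_pd2 {g : ℝ × ℝ → ℝ} (hg : ContDiff ℝ 1 g) : Continuous (pd2 g) := by
  have h : pd2 g = fun x => fderiv ℝ g x (0, 1) := by
    funext x
    have h1 : HasFDerivAt g (fderiv ℝ g x) (x.1, x.2) :=
      (hg.differentiable one_ne_zero x).hasFDerivAt
    exact (h1.comp_hasDerivAt x.2 ((hasDerivAt_const x.2 x.1).prodMk (hasDerivAt_id x.2))).deriv
  rw [h]
  exact (hg.continuous_fderiv one_ne_zero).clm_apply continuous_const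

/-- An integrable function on the line with integrable derivative is bounded by the `L¹` norm
of its derivative. -/
lemma abs_le_integral_abs_deriv {u u' : ℝ → ℝ} (hu : ∀ x, HasDerivAt u (u' x) x)
    (hi : Integrable u) (hi' : Integrable u') (x : ℝ) : |u x| ≤ ∫ y, |u' y| := by
  have hlim : Filter.Tendsto u Filter.atBot (nhds 0) :=
    tendsto_zero_of_hasDerivAt_of_integrableOn_Iic (a := x) (fun y _ => hu y)
      hi'.integrableOn hi.integrableOn
  have h := integral_Iic_of_hasDerivAt_of_tendsto' (a := x) (fun y _ => hu y)
    hi'.integrableOn hlim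
  rw [sub_zero] at h
  rw [← h]
  exact abs_integral_le_integral_abs.trans
    (setIntegral_le_integral hi'.abs (Filter.Eventually.of_forall fun y => abs_nonneg _))

/-- A `C¹` function on `[0,1)` is bounded by its `W^{1,1}` norm. -/
lemma abs_le_integral_abs_add_deriv {u u' : ℝ → ℝ} (hu : ∀ x, HasDerivAt u (u' x) x)
    (hc : Continuous u') {x : ℝ} (hx : x ∈ Set.Ico (0:ℝ) 1) :
    |u x| ≤ ∫ y in Set.Ico (0:ℝ) 1, (|u y| + |u' y|) := by
  have hcu : Continuous u := continuous_iff_continuousAt.2 fun y => (hu y).continuousAt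
  have hint : ∀ {g : ℝ → ℝ}, Continuous g → IntegrableOn g (Set.Ico (0:ℝ) 1) := fun hg =>
    (hg.integrableOn_Icc (a := 0) (b := 1)).mono_set Set.Ico_subset_Icc_self
  set K := ∫ y in Set.Ico (0:ℝ) 1, |u' y| with hK
  have key : ∀ y ∈ Set.Ico (0:ℝ) 1, |u x| - K ≤ |u y| := by
    intro y hy
    have h := intervalIntegral.integral_eq_sub_of_hasDerivAt (a := y) (b := x)
      (fun z _ => hu z) (hc.intervalIntegrable _ _)
    have h2 : |u x - u y| ≤ K := by
      rw [← h]
      refine (intervalIntegral.norm_integral_le_integral_norm_uIoc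
        (f := u') (μ := volume)).trans ?_
      refine setIntegral_mono_set (hint hc.abs)
        (Filter.Eventually.of_forall fun z => abs_nonneg _) (LE.le.eventuallyLE ?_)
      intro z hz
      rcases Set.mem_uIoc.1 hz with hz | hz
      · exact ⟨hy.1.trans hz.1.le, hz.2.trans_lt hx.2⟩
      · exact ⟨hx.1.trans hz.1.le, hz.2.trans_lt hy.2⟩
    have h3 := abs_sub_abs_le_abs_sub (u x) (u y)
    linarith
  have hmono : ∫ _ in Set.Ico (0:ℝ) 1, (|u x| - K) ≤ ∫ y in Set.Ico (0:ℝ) 1, |u y| :=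
    setIntegral_mono_on (hint continuous_const) (hint hcu.abs) measurableSet_Ico key
  rw [integral_add (hint hcu.abs) (hint hc.abs)]
  simp only [setIntegral_const, Real.volume_real_Ico, sub_zero, zero_le_one, sup_of_le_left,
    one_smul] at hmono
  linarith

/-- The Gagliardo–Nirenberg inequality `W^{1,1} ⊂ L²` on the cylinder. -/
lemma integral_sq_le_mul {u : ℝ × ℝ → ℝ} (hu : ContDiff ℝ 1 u) (hi : Integrable u μΩ)
    (hi1 : Integrable (pd1 u) μΩ) (hi2 : Integrable (pd2 u) μΩ) :
    Integrable (fun x => u x ^ 2) μΩ ∧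
      ∫ x, u x ^ 2 ∂μΩ ≤ (∫ x, |pd1 u x| ∂μΩ) * (∫ x, (|u x| + |pd2 u x|) ∂μΩ) := by
  have hsum : Integrable (fun x => |u x| + |pd2 u x|) μΩ := hi.abs.add hi2.abs
  rw [μΩ_eq_prod] at *
  set ν := (volume : Measure ℝ).restrict (Set.Ico 0 1) with hν
  set a : ℝ → ℝ := fun t => ∫ s, |pd1 u (s, t)| with ha
  set b : ℝ → ℝ := fun s => ∫ t, (|u (s, t)| + |pd2 u (s, t)|) ∂ν with hb
  have hai : Integrable a ν := hi1.abs.integral_prod_right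
  have hbi : Integrable b := hsum.integral_prod_left
  have hprod : Integrable (fun x : ℝ × ℝ => b x.1 * a x.2) (volume.prod ν) := hbi.mul_prod hai
  have hA : ∀ᵐ t ∂ν, ∀ s, |u (s, t)| ≤ a t := by
    filter_upwards [hi.prod_left_ae, hi1.prod_left_ae] with t h h1 s
    exact abs_le_integral_abs_deriv (fun y => hasDerivAt_pd1 hu (y, t)) h h1 s
  have hB : ∀ᵐ t ∂ν, ∀ s, |u (s, t)| ≤ b s := by
    filter_upwards [ae_restrict_mem measurableSet_Ico] with t ht s
    exact abs_le_integral_abs_add_deriv (u := fun y => u (s, y)) (u' := fun y => pd2 u (s, y))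
      (fun y => hasDerivAt_pd2 hu (s, y))
      ((continuous_pd2 hu).comp (by fun_prop : Continuous fun y : ℝ => (s, y))) ht
  have hle : ∀ᵐ x ∂(volume : Measure ℝ).prod ν, u x ^ 2 ≤ b x.1 * a x.2 := by
    filter_upwards [Measure.quasiMeasurePreserving_snd.ae hA,
      Measure.quasiMeasurePreserving_snd.ae hB] with x h1 h2
    rw [← sq_abs, sq]
    exact mul_le_mul (h2 x.1) (h1 x.1) (abs_nonneg _) ((abs_nonneg _).trans (h2 x.1))
  have hsq : Integrable (fun x => u x ^ 2) ((volume : Measure ℝ).prod ν) := by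
    refine hprod.mono' (hu.continuous.pow 2).aestronglyMeasurable ?_
    filter_upwards [hle] with x hx
    rwa [Real.norm_of_nonneg (sq_nonneg _)]
  refine ⟨hsq, (integral_mono_ae hsq hprod hle).trans ?_⟩
  rw [integral_prod_mul, mul_comm, integral_prod_symm _ hi1.abs, integral_prod _ hsum]

/-- Cauchy–Schwarz, with the square roots on the right. -/
lemma integral_abs_mul_le_sqrt {α : Type*} [MeasurableSpace α] {μ : Measure α} {f g : α → ℝ}
    (hf : MemLp f 2 μ) (hg : MemLp g 2 μ) :
    ∫ x, |f x * g x| ∂μ ≤ √(∫ x, f x ^ 2 ∂μ) * √(∫ x, g x ^ 2 ∂μ) := by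
  have h := integral_mul_norm_le_Lp_mul_Lq (μ := μ) (f := f) (g := g)
    Real.HolderConjugate.two_two (by simpa using hf) (by simpa using hg)
  simpa [Real.sqrt_eq_rpow, abs_mul] using h

/-- Interpolation of `L²` between `L¹` and `L⁴`. -/
lemma integral_sq_pow_three_le {α : Type*} [MeasurableSpace α] {μ : Measure α} {f : α → ℝ}
    (h1 : Integrable f μ) (h2 : Integrable (fun x => f x ^ 2) μ)
    (h4 : Integrable (fun x => f x ^ 4) μ) (hpos : 0 < ∫ x, |f x| ∂μ)
    (hpos2 : 0 < ∫ x, f x ^ 2 ∂μ) :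
    (∫ x, f x ^ 2 ∂μ) ^ 3 ≤ (∫ x, |f x| ∂μ) ^ 2 * ∫ x, f x ^ 4 ∂μ := by
  set A := ∫ x, |f x| ∂μ
  set M := ∫ x, f x ^ 2 ∂μ
  set Q := ∫ x, f x ^ 4 ∂μ
  have key : ∀ s : ℝ, 0 < s → 3 * s ^ 2 * M ≤ 2 * s ^ 3 * A + Q := by
    intro s hs
    rw [← integral_const_mul, ← integral_const_mul, ← integral_add (h1.abs.const_mul _) h4]
    refine integral_mono (h2.const_mul _) ((h1.abs.const_mul _).add h4) fun x => ?_
    have ht := abs_nonneg (f x)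
    have e2 : f x ^ 2 = |f x| ^ 2 := (sq_abs _).symm
    have e4 : f x ^ 4 = |f x| ^ 4 := by rw [← abs_pow, abs_of_nonneg (by positivity)]
    simp only [e2, e4]
    nlinarith [mul_nonneg ht (mul_nonneg (sq_nonneg (|f x| - s))
      (by positivity : (0:ℝ) ≤ |f x| + 2 * s))]
  have h := key (M / A) (by positivity)
  have e : 3 * (M / A) ^ 2 * M - 2 * (M / A) ^ 3 * A = M ^ 3 / A ^ 2 := by
    field_simp
    ring
  have hQ : M ^ 3 / A ^ 2 ≤ Q := by linarith
  rwa [div_le_iff₀ (by positivity), mul_comm] at hQ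

/-- Ladyzhenskaya's inequality on the cylinder. -/
lemma integral_pow_four_le {f : ℝ × ℝ → ℝ} (hf : ContDiff ℝ 1 f)
    (h2 : Integrable (fun x => f x ^ 2) μΩ)
    (hg : Integrable (fun x => pd1 f x ^ 2 + pd2 f x ^ 2) μΩ) :
    Integrable (fun x => f x ^ 4) μΩ ∧
      ∫ x, f x ^ 4 ∂μΩ ≤ 2 * (L2norm f * GradL2norm f) *
        (L2norm f ^ 2 + 2 * (L2norm f * GradL2norm f)) := by
  have hc1 := continuous_pd1 hf
  have hc2 := continuous_pd2 hf
  have hi1 : Integrable (fun x => pd1 f x ^ 2) μΩ :=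
    hg.mono' (hc1.pow 2).aestronglyMeasurable (Filter.Eventually.of_forall fun x => by
      rw [Real.norm_of_nonneg (sq_nonneg _)]; linarith [sq_nonneg (pd2 f x)])
  have hi2 : Integrable (fun x => pd2 f x ^ 2) μΩ :=
    hg.mono' (hc2.pow 2).aestronglyMeasurable (Filter.Eventually.of_forall fun x => by
      rw [Real.norm_of_nonneg (sq_nonneg _)]; linarith [sq_nonneg (pd1 f x)])
  have hL := (memLp_two_iff_integrable_sq hf.continuous.aestronglyMeasurable).2 h2
  have hL1 := (memLp_two_iff_integrable_sq hc1.aestronglyMeasurable).2 hi1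
  have hL2 := (memLp_two_iff_integrable_sq hc2.aestronglyMeasurable).2 hi2
  have hu : ContDiff ℝ 1 fun x => f x ^ 2 := hf.pow 2
  have e1 : pd1 (fun x => f x ^ 2) = fun x => 2 * (f x * pd1 f x) := by
    funext x
    refine ((hasDerivAt_pd1 hf x).pow 2).deriv.trans ?_
    simp [mul_assoc]
  have e2 : pd2 (fun x => f x ^ 2) = fun x => 2 * (f x * pd2 f x) := by
    funext x
    refine ((hasDerivAt_pd2 hf x).pow 2).deriv.trans ?_
    simp [mul_assoc]
  have hm1 : Integrable (fun x => f x * pd1 f x) μΩ := hL.integrable_mul hL1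
  have hm2 : Integrable (fun x => f x * pd2 f x) μΩ := hL.integrable_mul hL2
  have hN : ∫ x, f x ^ 2 ∂μΩ = L2norm f ^ 2 :=
    (Real.sq_sqrt (integral_nonneg fun x => sq_nonneg _)).symm
  have b1 : ∫ x, |f x * pd1 f x| ∂μΩ ≤ L2norm f * GradL2norm f := by
    refine (integral_abs_mul_le_sqrt hL hL1).trans
      (mul_le_mul_of_nonneg_left (Real.sqrt_le_sqrt ?_) (Real.sqrt_nonneg _))
    exact integral_mono hi1 hg fun x => le_add_of_nonneg_right (sq_nonneg _)
  have b2 : ∫ x, |f x * pd2 f x| ∂μΩ ≤ L2norm f * GradL2norm f := by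
    refine (integral_abs_mul_le_sqrt hL hL2).trans
      (mul_le_mul_of_nonneg_left (Real.sqrt_le_sqrt ?_) (Real.sqrt_nonneg _))
    exact integral_mono hi2 hg fun x => le_add_of_nonneg_left (sq_nonneg _)
  obtain ⟨hint, hle⟩ := integral_sq_le_mul hu h2 (e1 ▸ hm1.const_mul 2) (e2 ▸ hm2.const_mul 2)
  simp only [← pow_mul, Nat.reduceMul] at hint hle
  refine ⟨hint, hle.trans ?_⟩
  simp only [e1, e2, abs_mul (2:ℝ), abs_two, abs_pow, sq_abs]
  rw [integral_add h2 (hm2.abs.const_mul 2), integral_const_mul, integral_const_mul, hN]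
  have p1 : 0 ≤ ∫ x, |f x * pd1 f x| ∂μΩ := integral_nonneg fun x => abs_nonneg _
  have p2 : 0 ≤ ∫ x, |f x * pd2 f x| ∂μΩ := integral_nonneg fun x => abs_nonneg _
  gcongr
  exact mul_nonneg zero_le_two (p1.trans b1)

/-- ψ-Nash inequality in `ℝ × 𝕋`:
`‖∇f‖_{L²} ≥ C ‖f‖_{L²} min { ‖f‖_{L²}/‖f‖_{L¹}, ‖f‖²_{L²}/‖f‖²_{L¹} }`
for every nonzero `f`. -/
theorem psi_nash_inequality :
    ∃ C > (0:ℝ), ∀ f : ℝ × ℝ → ℝ, ContDiff ℝ 1 f → Periodic2 f → f ≠ 0 →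
      Integrable f μΩ → Integrable (fun x => f x ^ 2) μΩ →
      Integrable (fun x => pd1 f x ^ 2 + pd2 f x ^ 2) μΩ →
      GradL2norm f ≥ C * L2norm f *
        min (L2norm f / L1norm f) (L2norm f ^ 2 / L1norm f ^ 2) := by
  refine ⟨1 / 4, by norm_num, fun f hf _ _ h1 h2 hg => ?_⟩
  obtain ⟨h4, hQ⟩ := integral_pow_four_le hf h2 hg
  have hN : ∫ x, f x ^ 2 ∂μΩ = L2norm f ^ 2 :=
    (Real.sq_sqrt (integral_nonneg fun x => sq_nonneg _)).symm
  have hN0 : 0 ≤ L2norm f := Real.sqrt_nonneg _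
  have hG0 : 0 ≤ GradL2norm f := Real.sqrt_nonneg _
  have hA0 : 0 ≤ L1norm f := integral_nonneg fun x => abs_nonneg _
  rcases hN0.eq_or_lt with hN1 | hN1
  · simpa [← hN1] using hG0
  rcases hA0.eq_or_lt with hA1 | hA1
  · simpa [← hA1] using hG0
  have hI := integral_sq_pow_three_le h1 h2 h4 hA1 (by rw [hN]; positivity)
  rw [hN, ← L1norm] at hI
  set N := L2norm f
  set G := GradL2norm f
  set A := L1norm f
  have hI' := hI.trans (mul_le_mul_of_nonneg_left hQ (sq_nonneg A))
  have hmain : N ^ 4 ≤ A ^ 2 * (2 * G * (N + 2 * G)) := by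
    refine le_of_mul_le_mul_left ?_ (by positivity : 0 < N ^ 2)
    linarith
  rcases le_total (2 * G) N with h | h
  · refine le_trans (mul_le_mul_of_nonneg_left (min_le_right _ _) (by positivity)) ?_
    rw [← mul_div_assoc, div_le_iff₀ (by positivity)]
    refine le_of_mul_le_mul_left ?_ hN1
    nlinarith [mul_le_mul_of_nonneg_left h (by positivity : 0 ≤ A ^ 2 * G)]
  · refine le_trans (mul_le_mul_of_nonneg_left (min_le_left _ _) (by positivity)) ?_
    rw [← mul_div_assoc, div_le_iff₀ hA1]
    refine le_of_sq_le_sq ?_ (by positivity)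
    nlinarith [mul_le_mul_of_nonneg_left h (by positivity : 0 ≤ A ^ 2 * G), sq_nonneg (A * G)]

end NS
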